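/- arXiv:2309.11713 — 2 statements merged into one kernel-verified Lean document; each statement's English description precedes it below -/
import Mathlib

section
/- Let d ≥ 2, p ≥ 1 a real number, and let μ, ν be Borel probability measures on ℝ^d with finite p-th moments. Then the map θ ↦ W_p^p(θ♯μ, θ♯ν) is a bounded continuous function on the unit sphere S^{d−1}, with W_p^p(θ♯μ, θ♯ν) ≤ W_p^p(μ, ν) for all θ ∈ S^{d−1}. -/
open MeasureTheory ENNReal Filter
open scoped RealInnerProductSpace NNReal

/-- A coupling of `μ` and `ν`: a probability measure on the product space whose
first marginal is `μ` and second marginal is `ν`. -/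
def IsCoupling {X Y : Type*} [MeasurableSpace X] [MeasurableSpace Y]
    (π : Measure (X × Y)) (μ : Measure X) (ν : Measure Y) : Prop :=
  IsProbabilityMeasure π ∧ π.map Prod.fst = μ ∧ π.map Prod.snd = ν

/-- `W_p^p(μ, ν)`: the infimum over couplings of `μ` and `ν` of the `p`-th power
transport cost `∫ ‖x - y‖^p dπ(x, y)`. -/
noncomputable def WppENN {X : Type*} [NormedAddCommGroup X] [MeasurableSpace X]
    (p : ℝ) (μ ν : Measure X) : ℝ≥0∞ :=
  ⨅ π ∈ {π : Measure (X × X) | IsCoupling π μ ν},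
    ∫⁻ q, (‖q.1 - q.2‖₊ : ℝ≥0∞) ^ p ∂π

/-- The Wasserstein distance of order `p`, `W_p(μ, ν)`, valued in `ℝ≥0∞`. -/
noncomputable def WassENN {X : Type*} [NormedAddCommGroup X] [MeasurableSpace X]
    (p : ℝ) (μ ν : Measure X) : ℝ≥0∞ := (WppENN p μ ν) ^ (1 / p)

/-- The Wasserstein distance of order `p`, `W_p(μ, ν)`, real-valued. -/
noncomputable def Wass {X : Type*} [NormedAddCommGroup X] [MeasurableSpace X]
    (p : ℝ) (μ ν : Measure X) : ℝ := (WassENN p μ ν).toReal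

/-- The uniform probability distribution `σ` on the unit sphere `S^{d-1} ⊆ ℝ^d`:
the `(d-1)`-dimensional Hausdorff measure restricted to the sphere, normalized
to total mass 1. -/
noncomputable def sphereUniform (d : ℕ) : Measure (EuclideanSpace ℝ (Fin d)) :=
  ((μH[(d : ℝ) - 1] : Measure (EuclideanSpace ℝ (Fin d)))
      (Metric.sphere (0 : EuclideanSpace ℝ (Fin d)) 1))⁻¹ •
    (μH[(d : ℝ) - 1] : Measure (EuclideanSpace ℝ (Fin d))).restrict
      (Metric.sphere (0 : EuclideanSpace ℝ (Fin d)) 1)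

/-- Two measures on products can be glued along a coupling of their first marginals. -/
lemma IsCoupling.exists_gluing {X Y X' Y' : Type*} [MeasurableSpace X] [MeasurableSpace Y]
    [MeasurableSpace X'] [MeasurableSpace Y'] [StandardBorelSpace X'] [StandardBorelSpace Y']
    [Nonempty X'] [Nonempty Y'] {ρ₁ : Measure (X × X')} {ρ₂ : Measure (Y × Y')}
    [IsProbabilityMeasure ρ₁] [IsProbabilityMeasure ρ₂] {π : Measure (X × Y)}
    (hπ : IsCoupling π ρ₁.fst ρ₂.fst) :
    ∃ γ : Measure ((X × Y) × (X' × Y')), IsProbabilityMeasure γ ∧ γ.map Prod.fst = π ∧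
      γ.map (fun z => (z.1.1, z.2.1)) = ρ₁ ∧ γ.map (fun z => (z.1.2, z.2.2)) = ρ₂ := by
  obtain ⟨hprob, h₁, h₂⟩ := hπ
  let κ₁ : ProbabilityTheory.Kernel (X × Y) X' :=
    ρ₁.condKernel.comap (Prod.fst : X × Y → X) measurable_fst
  let κ₂ : ProbabilityTheory.Kernel (X × Y) Y' :=
    ρ₂.condKernel.comap (Prod.snd : X × Y → Y) measurable_snd
  refine ⟨π.compProd (ProbabilityTheory.Kernel.prod κ₁ κ₂), inferInstance, Measure.fst_compProd _ _,
    ?_, ?_⟩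
  · refine Measure.ext_of_lintegral _ fun f hf => ?_
    rw [lintegral_map hf (by fun_prop), Measure.lintegral_compProd (by fun_prop)]
    conv_rhs => rw [← ρ₁.disintegrate ρ₁.condKernel, Measure.lintegral_compProd hf, ← h₁,
      lintegral_map hf.lintegral_kernel_prod_right' measurable_fst]
    refine lintegral_congr fun a => ?_
    rw [ProbabilityTheory.Kernel.prod_apply, lintegral_prod _ (by fun_prop)]
    simp [κ₁]
  · refine Measure.ext_of_lintegral _ fun f hf => ?_
    rw [lintegral_map hf (by fun_prop), Measure.lintegral_compProd (by fun_prop)]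
    conv_rhs => rw [← ρ₂.disintegrate ρ₂.condKernel, Measure.lintegral_compProd hf, ← h₂,
      lintegral_map hf.lintegral_kernel_prod_right' measurable_snd]
    refine lintegral_congr fun a => ?_
    rw [ProbabilityTheory.Kernel.prod_apply, lintegral_prod _ (by fun_prop)]
    simp [κ₂]

/-- A coupling pushes forward to a coupling of the pushforwards. -/
lemma IsCoupling.map {X Y X' Y' : Type*} [MeasurableSpace X] [MeasurableSpace Y]
    [MeasurableSpace X'] [MeasurableSpace Y'] {π : Measure (X × Y)} {μ : Measure X} {ν : Measure Y}
    (hπ : IsCoupling π μ ν) {f : X → X'} {g : Y → Y'} (hf : Measurable f) (hg : Measurable g) :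
    IsCoupling (π.map (Prod.map f g)) (μ.map f) (ν.map g) := by
  obtain ⟨hprob, rfl, rfl⟩ := hπ
  refine ⟨Measure.isProbabilityMeasure_map (by fun_prop), ?_, ?_⟩
  · rw [Measure.map_map (by fun_prop) (by fun_prop), Measure.map_map (by fun_prop) (by fun_prop)]
    rfl
  · rw [Measure.map_map (by fun_prop) (by fun_prop), Measure.map_map (by fun_prop) (by fun_prop)]
    rfl

section WassENN

variable {X : Type*} [NormedAddCommGroup X] [MeasurableSpace X] {p : ℝ} {μ ν : Measure X}

lemma WppENN_le_lintegral {π : Measure (X × X)} (hπ : IsCoupling π μ ν) :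
    WppENN p μ ν ≤ ∫⁻ q, ‖q.1 - q.2‖ₑ ^ p ∂π :=
  iInf₂_le π hπ

lemma WassENN_le_eLpNorm' (hp : 0 < p) {π : Measure (X × X)} (hπ : IsCoupling π μ ν) :
    WassENN p μ ν ≤ eLpNorm' (fun q => q.1 - q.2) p π :=
  ENNReal.rpow_le_rpow (WppENN_le_lintegral hπ) (by positivity)

lemma le_WassENN (hp : 0 < p) {c : ℝ≥0∞}
    (h : ∀ π : Measure (X × X), IsCoupling π μ ν → c ≤ eLpNorm' (fun q => q.1 - q.2) p π) :
    c ≤ WassENN p μ ν := by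
  rw [WassENN, one_div, ENNReal.le_rpow_inv_iff hp]
  exact le_iInf₂ fun π hπ => (ENNReal.le_rpow_inv_iff hp).1
    ((h π hπ).trans_eq (by rw [eLpNorm', one_div]; rfl))

end WassENN

section Pushforward

variable {E F : Type*} [MeasurableSpace E] [NormedAddCommGroup F] [MeasurableSpace F]
  [BorelSpace F] [SecondCountableTopology F] {p : ℝ} {μ ν : Measure E}

lemma eLpNorm'_map {A B : Type*} [MeasurableSpace A] [MeasurableSpace B] {η : Measure A}
    {g : A → B} (hg : Measurable g) {φ : B → F} (hφ : Measurable φ) :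
    eLpNorm' φ p (η.map g) = eLpNorm' (φ ∘ g) p η := by
  simp only [eLpNorm', Function.comp_apply]
  rw [lintegral_map (by fun_prop) hg]

/-- The Wasserstein distance between pushforwards is stable under perturbing the maps in `L^p`. -/
lemma WassENN_map_le_add [StandardBorelSpace E] [Nonempty E] (hp : 1 ≤ p)
    [IsProbabilityMeasure μ] [IsProbabilityMeasure ν]
    {f f' : E → F} (hf : Measurable f) (hf' : Measurable f') :
    WassENN p (μ.map f') (ν.map f') ≤
      WassENN p (μ.map f) (ν.map f) + (eLpNorm' (f' - f) p μ + eLpNorm' (f - f') p ν) := by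
  have hp0 : 0 < p := by positivity
  rw [← tsub_le_iff_right]
  refine le_WassENN hp0 fun π hπ => ?_
  rw [tsub_le_iff_right]
  have hfst (η : Measure E) : (η.map fun x => (f x, x)).fst = η.map f := by
    rw [Measure.fst_map_prodMk measurable_id']
  have : IsProbabilityMeasure (μ.map fun x => (f x, x)) :=
    Measure.isProbabilityMeasure_map (by fun_prop)
  have : IsProbabilityMeasure (ν.map fun x => (f x, x)) :=
    Measure.isProbabilityMeasure_map (by fun_prop)
  rw [← hfst μ, ← hfst ν] at hπ
  obtain ⟨γ, hγ, hγπ, hγμ, hγν⟩ := hπ.exists_gluing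
  have hcoup : IsCoupling (γ.map Prod.snd) μ ν := by
    refine ⟨Measure.isProbabilityMeasure_map (by fun_prop), ?_, ?_⟩
    · have h := congrArg (Measure.map Prod.snd) hγμ
      rw [Measure.map_map (by fun_prop) (by fun_prop),
        Measure.map_map (by fun_prop) (by fun_prop)] at h
      rw [Measure.map_map (by fun_prop) (by fun_prop)]
      exact h.trans Measure.map_id
    · have h := congrArg (Measure.map Prod.snd) hγν
      rw [Measure.map_map (by fun_prop) (by fun_prop),
        Measure.map_map (by fun_prop) (by fun_prop)] at h
      rw [Measure.map_map (by fun_prop) (by fun_prop)]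
      exact h.trans Measure.map_id
  have hπ' : eLpNorm' (fun z : (F × F) × (E × E) => z.1.1 - z.1.2) p γ =
      eLpNorm' (fun q => q.1 - q.2) p π := by
    rw [← hγπ, eLpNorm'_map (by fun_prop) (by fun_prop)]; rfl
  have hμ' : eLpNorm' (fun z : (F × F) × (E × E) => f' z.2.1 - z.1.1) p γ =
      eLpNorm' (f' - f) p μ := by
    have h := congrArg (eLpNorm' (fun q : F × E => f' q.2 - q.1) p) hγμ
    rwa [eLpNorm'_map (by fun_prop) (by fun_prop), eLpNorm'_map (by fun_prop) (by fun_prop)] at h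
  have hν' : eLpNorm' (fun z : (F × F) × (E × E) => z.1.2 - f' z.2.2) p γ =
      eLpNorm' (f - f') p ν := by
    have h := congrArg (eLpNorm' (fun q : F × E => q.1 - f' q.2) p) hγν
    rwa [eLpNorm'_map (by fun_prop) (by fun_prop), eLpNorm'_map (by fun_prop) (by fun_prop)] at h
  refine (WassENN_le_eLpNorm' hp0 (hcoup.map hf' hf')).trans ?_
  rw [eLpNorm'_map (by fun_prop) (by fun_prop), eLpNorm'_map (by fun_prop) (by fun_prop),
    ← hπ', ← hμ', ← hν']
  have hsum : ((fun q : F × F => q.1 - q.2) ∘ Prod.map f' f') ∘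
      (Prod.snd : (F × F) × (E × E) → E × E) =
      (fun z => z.1.1 - z.1.2) + ((fun z => f' z.2.1 - z.1.1) + fun z => z.1.2 - f' z.2.2) := by
    ext z
    simp only [Function.comp_apply, Prod.map_fst, Prod.map_snd, Pi.add_apply]
    abel
  rw [hsum]
  refine (eLpNorm'_add_le (by fun_prop) (by fun_prop) hp).trans ?_
  gcongr
  exact eLpNorm'_add_le (by fun_prop) (by fun_prop) hp

lemma WassENN_map_zero [IsProbabilityMeasure μ] [IsProbabilityMeasure ν] (hp : 0 < p) :
    WassENN p (μ.map fun _ => (0 : F)) (ν.map fun _ => (0 : F)) = 0 := by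
  have hcoup : IsCoupling (Measure.dirac ((0 : F), (0 : F))) (Measure.dirac 0)
      (Measure.dirac 0) :=
    ⟨inferInstance, Measure.map_dirac' measurable_fst _, Measure.map_dirac' measurable_snd _⟩
  have h := WassENN_le_eLpNorm' hp hcoup
  simpa [eLpNorm', hp, Measure.map_const] using h

/-- A map that does not increase distances does not increase the Wasserstein distance. -/
lemma WassENN_map_le_of_lipschitzWith_one {E : Type*} [NormedAddCommGroup E] [MeasurableSpace E]
    [BorelSpace E] {μ ν : Measure E} (hp : 0 < p) {f : E → F} (hf : LipschitzWith 1 f) :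
    WassENN p (μ.map f) (ν.map f) ≤ WassENN p μ ν := by
  have hfm : Measurable f := hf.continuous.measurable
  refine le_WassENN hp fun π hπ => ?_
  refine (WassENN_le_eLpNorm' hp (hπ.map hfm hfm)).trans ?_
  simp only [eLpNorm']
  rw [lintegral_map (by fun_prop) (by fun_prop)]
  gcongr with q
  simpa [edist_eq_enorm_sub] using hf q.1 q.2

end Pushforward

lemma WassENN_ne_top {E : Type*} [NormedAddCommGroup E] [MeasurableSpace E] [BorelSpace E]
    [SecondCountableTopology E] [StandardBorelSpace E] {p : ℝ} (hp : 1 ≤ p) {μ ν : Measure E}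
    [IsProbabilityMeasure μ] [IsProbabilityMeasure ν]
    (hμ : eLpNorm' id p μ ≠ ⊤) (hν : eLpNorm' id p ν ≠ ⊤) : WassENN p μ ν ≠ ⊤ := by
  have h := WassENN_map_le_add (p := p) (μ := μ) (ν := ν) hp
    (f := fun _ => (0 : E)) (f' := id) measurable_const measurable_id
  rw [WassENN_map_zero (by positivity), Measure.map_id, Measure.map_id, zero_add] at h
  refine ne_top_of_le_ne_top (ENNReal.add_ne_top.2 ⟨hμ, hν⟩) (h.trans_eq ?_)
  simp [eLpNorm']

lemma eLpNorm'_inner_sub_inner_le {E : Type*} [NormedAddCommGroup E] [InnerProductSpace ℝ E]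
    [MeasurableSpace E] [BorelSpace E] {p : ℝ} (hp : 0 < p) (μ : Measure E) (θ θ' : E) :
    eLpNorm' ((fun x => ⟪θ', x⟫) - fun x => ⟪θ, x⟫) p μ ≤ ‖θ' - θ‖ₑ * eLpNorm' id p μ := by
  rw [← ENNReal.rpow_le_rpow_iff hp, ENNReal.mul_rpow_of_nonneg _ _ hp.le]
  simp only [eLpNorm']
  rw [one_div, ENNReal.rpow_inv_rpow hp.ne', ENNReal.rpow_inv_rpow hp.ne',
    ← lintegral_const_mul _ (by fun_prop)]
  refine lintegral_mono fun x => ?_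
  rw [← ENNReal.mul_rpow_of_nonneg _ _ hp.le]
  gcongr
  simp only [Pi.sub_apply, id, ← inner_sub_left]
  simp only [enorm_eq_nnnorm]
  exact_mod_cast nnnorm_inner_le_nnnorm (𝕜 := ℝ) (θ' - θ) x

/-- `θ ↦ W_p^p(θ♯μ, θ♯ν)` is a bounded continuous function on the unit
sphere, bounded by `W_p^p(μ, ν)`. -/
theorem wasserstein_pow_proj_boundedContinuous_on_sphere
    (d : ℕ) (hd : 2 ≤ d) (p : ℝ) (hp : 1 ≤ p)
    (μ ν : Measure (EuclideanSpace ℝ (Fin d)))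
    [IsProbabilityMeasure μ] [IsProbabilityMeasure ν]
    (hμ : ∫⁻ x, (‖x‖₊ : ℝ≥0∞) ^ p ∂μ ≠ ⊤)
    (hν : ∫⁻ x, (‖x‖₊ : ℝ≥0∞) ^ p ∂ν ≠ ⊤) :
    ContinuousOn
      (fun θ : EuclideanSpace ℝ (Fin d) =>
        Wass p (μ.map fun x => ⟪θ, x⟫) (ν.map fun x => ⟪θ, x⟫) ^ p)
      (Metric.sphere (0 : EuclideanSpace ℝ (Fin d)) 1) ∧
    ∀ θ ∈ Metric.sphere (0 : EuclideanSpace ℝ (Fin d)) 1,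
      Wass p (μ.map fun x => ⟪θ, x⟫) (ν.map fun x => ⟪θ, x⟫) ^ p ≤ Wass p μ ν ^ p := by
  have hp0 : 0 < p := by positivity
  have hμ' : eLpNorm' id p μ ≠ ⊤ := ENNReal.rpow_ne_top_of_nonneg (by positivity) hμ
  have hν' : eLpNorm' id p ν ≠ ⊤ := ENNReal.rpow_ne_top_of_nonneg (by positivity) hν
  set C : ℝ≥0∞ := eLpNorm' id p μ + eLpNorm' id p ν with hC_def
  have hC : C ≠ ⊤ := ENNReal.add_ne_top.2 ⟨hμ', hν'⟩
  have hstep (θ θ' : EuclideanSpace ℝ (Fin d)) :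
      WassENN p (μ.map fun x => ⟪θ', x⟫) (ν.map fun x => ⟪θ', x⟫) ≤
        WassENN p (μ.map fun x => ⟪θ, x⟫) (ν.map fun x => ⟪θ, x⟫) + C * ‖θ' - θ‖ₑ := by
    refine (WassENN_map_le_add hp (f := fun x => ⟪θ, x⟫) (by fun_prop) (by fun_prop)).trans ?_
    gcongr
    rw [hC_def, mul_comm, mul_add]
    refine add_le_add (eLpNorm'_inner_sub_inner_le hp0 μ θ θ') ?_
    rw [← enorm_neg (θ' - θ), neg_sub]
    exact eLpNorm'_inner_sub_inner_le hp0 ν θ' θ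
  have hfin (θ : EuclideanSpace ℝ (Fin d)) :
      WassENN p (μ.map fun x => ⟪θ, x⟫) (ν.map fun x => ⟪θ, x⟫) ≠ ⊤ := by
    refine ne_top_of_le_ne_top ?_ (hstep 0 θ)
    simp only [inner_zero_left, WassENN_map_zero hp0, zero_add]
    exact ENNReal.mul_ne_top hC enorm_ne_top
  constructor
  · have hlip : LipschitzWith C.toNNReal fun θ : EuclideanSpace ℝ (Fin d) =>
        Wass p (μ.map fun x => ⟪θ, x⟫) (ν.map fun x => ⟪θ, x⟫) := by
      refine LipschitzWith.of_le_add_mul _ fun θ' θ => ?_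
      have hCθ : C * ‖θ' - θ‖ₑ ≠ ⊤ := ENNReal.mul_ne_top hC enorm_ne_top
      have h := ENNReal.toReal_mono (ENNReal.add_ne_top.2 ⟨hfin θ, hCθ⟩) (hstep θ θ')
      rw [ENNReal.toReal_add (hfin θ) hCθ, ENNReal.toReal_mul, toReal_enorm] at h
      rwa [dist_eq_norm]
    exact (hlip.continuous.rpow_const fun _ => Or.inr hp0.le).continuousOn
  · intro θ hθ
    have hlip : LipschitzWith 1 fun x : EuclideanSpace ℝ (Fin d) => ⟪θ, x⟫ := by
      refine LipschitzWith.of_dist_le_mul fun x y => ?_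
      rw [dist_eq_norm, dist_eq_norm, ← inner_sub_right]
      simpa [mem_sphere_zero_iff_norm.1 hθ] using norm_inner_le_norm (𝕜 := ℝ) θ (x - y)
    exact Real.rpow_le_rpow ENNReal.toReal_nonneg
      (ENNReal.toReal_mono (WassENN_ne_top hp hμ' hν')
        (WassENN_map_le_of_lipschitzWith_one hp0 hlip)) hp0.le
end

section
/- (Proposition 1, general form.) Let d ≥ 2, p ≥ 1 a real number, and let μ, ν be Borel probability measures on ℝ^d with finite p-th moments. For each L ∈ ℕ, let θ_1^{(L)}, …, θ_L^{(L)} ∈ S^{d−1} be points whose empirical measures γ_L = (1/L) ∑_{l=1}^L δ_{θ_l^{(L)}} converge weakly to the uniform distribution σ on S^{d−1} as L → ∞. Then the Quasi-Sliced Wasserstein approximations converge to the Sliced Wasserstein distance: (1/L) ∑_{l=1}^L W_p^p(θ_l^{(L)}♯μ, θ_l^{(L)}♯ν) → SW_p^p(μ, ν) as L → ∞. -/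
open MeasureTheory ENNReal Filter
open scoped RealInnerProductSpace NNReal

/-- A measure on `A × B` whose first marginal is the pushforward of `μ` under `f : X → A` lifts to a
measure on `X × B` with first marginal `μ`. -/
theorem exists_lift_fst {X A B : Type*} [MeasurableSpace X] [MeasurableSpace A]
    [MeasurableSpace B] [StandardBorelSpace B] [Nonempty B] {μ : Measure X}
    [IsProbabilityMeasure μ] {f : X → A} (hf : Measurable f) {π : Measure (A × B)}
    [IsProbabilityMeasure π] (hπ : π.map Prod.fst = μ.map f) :
    ∃ γ : Measure (X × B), IsProbabilityMeasure γ ∧ γ.map Prod.fst = μ ∧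
      γ.map (Prod.map f id) = π := by
  refine ⟨μ.compProd (π.condKernel.comap f hf), inferInstance, Measure.fst_compProd _ _, ?_⟩
  conv_rhs => rw [← π.disintegrate π.condKernel, Measure.fst, hπ]
  ext s hs
  have hm : Measurable (Prod.map f (id : B → B)) := hf.prodMap measurable_id
  have := Measure.isProbabilityMeasure_map (μ := μ) hf.aemeasurable
  rw [Measure.map_apply hm hs, Measure.compProd_apply (hm hs), Measure.compProd_apply hs,
    lintegral_map (ProbabilityTheory.Kernel.measurable_kernel_prodMk_left hs) hf]
  rfl

/-- Every coupling of pushforwards is the pushforward of a coupling. -/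
theorem IsCoupling.exists_lift {X Y A B : Type*} [MeasurableSpace X] [MeasurableSpace Y]
    [MeasurableSpace A] [MeasurableSpace B] [StandardBorelSpace X] [Nonempty X]
    [StandardBorelSpace B] [Nonempty B] {μ : Measure X} {ν : Measure Y}
    [IsProbabilityMeasure μ] [IsProbabilityMeasure ν] {f : X → A} {g : Y → B}
    (hf : Measurable f) (hg : Measurable g) {π : Measure (A × B)}
    (hπ : IsCoupling π (μ.map f) (ν.map g)) :
    ∃ γ : Measure (X × Y), IsCoupling γ μ ν ∧ γ.map (Prod.map f g) = π := by
  obtain ⟨_, h₁, h₂⟩ := hπ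
  obtain ⟨γ, _, hγ₁, hγ⟩ := exists_lift_fst hf h₁
  have hfid : Measurable (Prod.map f (id : B → B)) := hf.prodMap measurable_id
  have hgid : Measurable (Prod.map g (id : X → X)) := hg.prodMap measurable_id
  have := Measure.isProbabilityMeasure_map (μ := γ) measurable_swap.aemeasurable
  have hswap : (γ.map Prod.swap).map Prod.fst = ν.map g := by
    rw [Measure.map_map measurable_fst measurable_swap, ← h₂, ← hγ,
      Measure.map_map measurable_snd hfid]
    rfl
  obtain ⟨ρ, _, hρ₁, hρ⟩ := exists_lift_fst hg hswap
  refine ⟨ρ.map Prod.swap, ⟨Measure.isProbabilityMeasure_map measurable_swap.aemeasurable,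
    ?_, ?_⟩, ?_⟩
  · rw [← hγ₁, Measure.map_map measurable_fst measurable_swap]
    have := congrArg (Measure.map Prod.snd) hρ
    rwa [Measure.map_map measurable_snd hgid,
      Measure.map_map measurable_snd measurable_swap] at this
  · rw [Measure.map_map measurable_snd measurable_swap]
    exact hρ₁
  · have := congrArg (Measure.map (Prod.map f id ∘ Prod.swap)) hρ
    rw [Measure.map_map (hfid.comp measurable_swap) hgid,
      Measure.map_map (hfid.comp measurable_swap) measurable_swap] at this
    rw [Measure.map_map (hf.prodMap hg) measurable_swap, ← hγ]
    exact this

theorem eLpNorm_id_ne_top {E : Type*} [NormedAddCommGroup E] [MeasurableSpace E] {p : ℝ}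
    {μ : Measure E} (hp : 0 < p) (h : ∫⁻ x, (‖x‖₊ : ℝ≥0∞) ^ p ∂μ ≠ ⊤) :
    eLpNorm id (ENNReal.ofReal p) μ ≠ ⊤ := by
  rw [eLpNorm_eq_lintegral_rpow_enorm_toReal (by simpa using hp) ofReal_ne_top,
    toReal_ofReal hp.le]
  exact ENNReal.rpow_ne_top_of_nonneg (by positivity) h

section Slice

variable {E : Type*} [NormedAddCommGroup E] [InnerProductSpace ℝ E] [MeasurableSpace E]
  [BorelSpace E] [SecondCountableTopology E] {p : ℝ} {μ ν : Measure E}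

theorem wassENN_map_inner_le (hp : 0 < p) {γ : Measure (E × E)} (hγ : IsCoupling γ μ ν) (θ : E) :
    WassENN p (μ.map fun x => ⟪θ, x⟫) (ν.map fun x => ⟪θ, x⟫) ≤
      eLpNorm (fun q : E × E => ⟪θ, q.1 - q.2⟫) (ENNReal.ofReal p) γ := by
  obtain ⟨_, h₁, h₂⟩ := hγ
  have hθ : Measurable fun x : E => ⟪θ, x⟫ := by fun_prop
  have hm : Measurable (Prod.map (fun x : E => ⟪θ, x⟫) fun x : E => ⟪θ, x⟫) := hθ.prodMap hθ
  rw [eLpNorm_eq_lintegral_rpow_enorm_toReal (by simpa using hp) ofReal_ne_top,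
    toReal_ofReal hp.le, WassENN]
  gcongr
  have hπ : IsCoupling (γ.map (Prod.map (fun x : E => ⟪θ, x⟫) fun x : E => ⟪θ, x⟫))
      (μ.map fun x => ⟪θ, x⟫) (ν.map fun x => ⟪θ, x⟫) := by
    refine ⟨Measure.isProbabilityMeasure_map hm.aemeasurable, ?_, ?_⟩
    · rw [Measure.map_map measurable_fst hm, ← h₁, Measure.map_map hθ measurable_fst]
      rfl
    · rw [Measure.map_map measurable_snd hm, ← h₂, Measure.map_map hθ measurable_snd]
      rfl
  rw [WppENN]
  refine iInf₂_le_of_le _ hπ ?_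
  rw [lintegral_map (by fun_prop) hm]
  simp [inner_sub_right, enorm_eq_nnnorm]

/-- The sliced `W_p` is at least any lower bound for the sliced costs of couplings upstairs. -/
theorem le_wassENN_map_inner [StandardBorelSpace E] [IsProbabilityMeasure μ]
    [IsProbabilityMeasure ν] (hp : 0 < p) (θ : E) {c : ℝ≥0∞}
    (h : ∀ γ : Measure (E × E), IsCoupling γ μ ν →
      c ≤ eLpNorm (fun q : E × E => ⟪θ, q.1 - q.2⟫) (ENNReal.ofReal p) γ) :
    c ≤ WassENN p (μ.map fun x => ⟪θ, x⟫) (ν.map fun x => ⟪θ, x⟫) := by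
  have hθ : Measurable fun x : E => ⟪θ, x⟫ := by fun_prop
  rw [WassENN, one_div, ENNReal.le_rpow_inv_iff hp]
  refine le_iInf₂ fun π hπ => ?_
  obtain ⟨γ, hγ, rfl⟩ := IsCoupling.exists_lift hθ hθ hπ
  rw [← ENNReal.le_rpow_inv_iff hp, ← one_div, lintegral_map (by fun_prop) (hθ.prodMap hθ)]
  refine (h γ hγ).trans_eq ?_
  rw [eLpNorm_eq_lintegral_rpow_enorm_toReal (by simpa using hp) ofReal_ne_top,
    toReal_ofReal hp.le]
  simp [inner_sub_right, enorm_eq_nnnorm]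

theorem IsCoupling.eLpNorm_inner_sub_le (hp : 1 ≤ p) {γ : Measure (E × E)}
    (hγ : IsCoupling γ μ ν) (θ : E) :
    eLpNorm (fun q : E × E => ⟪θ, q.1 - q.2⟫) (ENNReal.ofReal p) γ ≤
      ‖θ‖ₑ * (eLpNorm id (ENNReal.ofReal p) μ + eLpNorm id (ENNReal.ofReal p) ν) := by
  obtain ⟨_, h₁, h₂⟩ := hγ
  have hp' : 1 ≤ ENNReal.ofReal p := by simpa using hp
  calc eLpNorm (fun q : E × E => ⟪θ, q.1 - q.2⟫) (ENNReal.ofReal p) γ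
      ≤ ENNReal.ofReal ‖θ‖ * eLpNorm (fun q : E × E => q.1 - q.2) (ENNReal.ofReal p) γ :=
        eLpNorm_le_mul_eLpNorm_of_ae_le_mul (.of_forall fun q => norm_inner_le_norm _ _) _
    _ ≤ ENNReal.ofReal ‖θ‖ * (eLpNorm (Prod.fst : E × E → E) (ENNReal.ofReal p) γ +
          eLpNorm (Prod.snd : E × E → E) (ENNReal.ofReal p) γ) := by
        gcongr
        exact eLpNorm_sub_le (by fun_prop) (by fun_prop) hp'
    _ = _ := by
        rw [← h₁, ← h₂, eLpNorm_map_measure (by fun_prop) (by fun_prop),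
          eLpNorm_map_measure (by fun_prop) (by fun_prop), ofReal_norm]
        rfl

theorem wassENN_map_inner_le_add [StandardBorelSpace E] [IsProbabilityMeasure μ]
    [IsProbabilityMeasure ν] (hp : 1 ≤ p) (θ θ' : E) :
    WassENN p (μ.map fun x => ⟪θ, x⟫) (ν.map fun x => ⟪θ, x⟫) ≤
      WassENN p (μ.map fun x => ⟪θ', x⟫) (ν.map fun x => ⟪θ', x⟫) +
        ‖θ - θ'‖ₑ * (eLpNorm id (ENNReal.ofReal p) μ + eLpNorm id (ENNReal.ofReal p) ν) := by
  have hp₀ : 0 < p := by linarith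
  rw [← tsub_le_iff_right]
  refine le_wassENN_map_inner hp₀ θ' fun γ hγ => ?_
  rw [tsub_le_iff_right]
  calc _ ≤ eLpNorm (fun q : E × E => ⟪θ, q.1 - q.2⟫) (ENNReal.ofReal p) γ :=
        wassENN_map_inner_le hp₀ hγ θ
    _ = eLpNorm ((fun q : E × E => ⟪θ', q.1 - q.2⟫) + fun q => ⟪θ - θ', q.1 - q.2⟫)
          (ENNReal.ofReal p) γ := by
        congr 1
        ext q
        simp [inner_sub_left]
    _ ≤ eLpNorm (fun q : E × E => ⟪θ', q.1 - q.2⟫) (ENNReal.ofReal p) γ +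
          eLpNorm (fun q : E × E => ⟪θ - θ', q.1 - q.2⟫) (ENNReal.ofReal p) γ :=
        eLpNorm_add_le (by fun_prop) (by fun_prop) (by simpa using hp)
    _ ≤ _ := by
        gcongr
        exact hγ.eLpNorm_inner_sub_le hp _

theorem wassENN_map_inner_le_mul [IsProbabilityMeasure μ] [IsProbabilityMeasure ν]
    (hp : 1 ≤ p) (θ : E) :
    WassENN p (μ.map fun x => ⟪θ, x⟫) (ν.map fun x => ⟪θ, x⟫) ≤
      ‖θ‖ₑ * (eLpNorm id (ENNReal.ofReal p) μ + eLpNorm id (ENNReal.ofReal p) ν) := by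
  have h : IsCoupling (μ.prod ν) μ ν := ⟨inferInstance, by simp, by simp⟩
  exact (wassENN_map_inner_le (by linarith) h θ).trans (h.eLpNorm_inner_sub_le hp θ)

theorem lipschitzWith_wass_map_inner [StandardBorelSpace E] [IsProbabilityMeasure μ]
    [IsProbabilityMeasure ν] (hp : 1 ≤ p) {K : ℝ≥0}
    (hK : (K : ℝ≥0∞) = eLpNorm id (ENNReal.ofReal p) μ + eLpNorm id (ENNReal.ofReal p) ν) :
    LipschitzWith K fun θ : E => Wass p (μ.map fun x => ⟪θ, x⟫) (ν.map fun x => ⟪θ, x⟫) := by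
  have hfin (θ : E) : WassENN p (μ.map fun x => ⟪θ, x⟫) (ν.map fun x => ⟪θ, x⟫) ≠ ⊤ :=
    ((wassENN_map_inner_le_mul hp θ).trans_lt (hK ▸ by finiteness)).ne
  refine LipschitzWith.of_le_add_mul K fun θ θ' => ?_
  have h := ENNReal.toReal_mono (ENNReal.add_ne_top.2 ⟨hfin θ', hK ▸ by finiteness⟩)
    (wassENN_map_inner_le_add (μ := μ) (ν := ν) hp θ θ')
  rw [ENNReal.toReal_add (hfin θ') (hK ▸ by finiteness), ← hK] at h
  simpa [Wass, dist_eq_norm, mul_comm] using h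

end Slice

theorem ae_sphereUniform_mem_sphere (d : ℕ) :
    ∀ᵐ θ ∂sphereUniform d, θ ∈ Metric.sphere (0 : EuclideanSpace ℝ (Fin d)) 1 :=
  Measure.ae_smul_measure (ae_restrict_mem Metric.isClosed_sphere.measurableSet) _

/-- Proposition 1, general form: if the empirical measures of point sets
`θ_1^{(L)}, …, θ_L^{(L)} ∈ S^{d−1}` converge weakly to the uniform distribution `σ` on the
sphere, then the QSW approximations converge to `SW_p^p(μ, ν)`. -/
theorem qsw_tendsto_sw
    (d : ℕ) (hd : 2 ≤ d) (p : ℝ) (hp : 1 ≤ p)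
    (μ ν : Measure (EuclideanSpace ℝ (Fin d)))
    [IsProbabilityMeasure μ] [IsProbabilityMeasure ν]
    (hμ : ∫⁻ x, (‖x‖₊ : ℝ≥0∞) ^ p ∂μ ≠ ⊤)
    (hν : ∫⁻ x, (‖x‖₊ : ℝ≥0∞) ^ p ∂ν ≠ ⊤)
    (θ : (L : ℕ) → Fin L → EuclideanSpace ℝ (Fin d))
    (hsphere : ∀ L (l : Fin L), θ L l ∈ Metric.sphere (0 : EuclideanSpace ℝ (Fin d)) 1)
    (hweak : ∀ g : EuclideanSpace ℝ (Fin d) → ℝ, Continuous g → (∃ C, ∀ x, |g x| ≤ C) →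
      Tendsto (fun L : ℕ => (L : ℝ)⁻¹ * ∑ l : Fin L, g (θ L l)) atTop
        (nhds (∫ x, g x ∂(sphereUniform d)))) :
    Tendsto
      (fun L : ℕ => (L : ℝ)⁻¹ * ∑ l : Fin L,
        Wass p (μ.map fun x => ⟪θ L l, x⟫) (ν.map fun x => ⟪θ L l, x⟫) ^ p)
      atTop
      (nhds (∫ θ', Wass p (μ.map fun x => ⟪θ', x⟫) (ν.map fun x => ⟪θ', x⟫) ^ p
        ∂(sphereUniform d))) := by
  have hp₀ : 0 < p := by linarith
  obtain ⟨K, hK⟩ : ∃ K : ℝ≥0, (K : ℝ≥0∞) =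
      eLpNorm id (ENNReal.ofReal p) μ + eLpNorm id (ENNReal.ofReal p) ν :=
    ⟨_, ENNReal.coe_toNNReal
      (ENNReal.add_ne_top.2 ⟨eLpNorm_id_ne_top hp₀ hμ, eLpNorm_id_ne_top hp₀ hν⟩)⟩
  let F : EuclideanSpace ℝ (Fin d) → ℝ := fun θ =>
    Wass p (μ.map fun x => ⟪θ, x⟫) (ν.map fun x => ⟪θ, x⟫)
  have hF₀ (θ) : 0 ≤ F θ := toReal_nonneg
  have hcont : Continuous F := (lipschitzWith_wass_map_inner hp hK).continuous
  have hbound {θ} (hθ : θ ∈ Metric.sphere (0 : EuclideanSpace ℝ (Fin d)) 1) : F θ ≤ K := by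
    have h := wassENN_map_inner_le_mul (μ := μ) (ν := ν) hp θ
    rw [← hK, ← ofReal_norm, mem_sphere_zero_iff_norm.1 hθ, ofReal_one, one_mul] at h
    exact ENNReal.toReal_le_coe_of_le_coe h
  have key := hweak (fun θ => min (F θ) K ^ p)
    ((hcont.min continuous_const).rpow_const fun _ => .inr hp₀.le)
    ⟨(K : ℝ) ^ p, fun θ => by
      have h₀ : 0 ≤ min (F θ) K := le_min (hF₀ θ) K.2
      rw [abs_of_nonneg (by positivity)]
      exact Real.rpow_le_rpow h₀ (min_le_right _ _) hp₀.le⟩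
  have hint : ∫ θ, min (F θ) K ^ p ∂sphereUniform d = ∫ θ, F θ ^ p ∂sphereUniform d :=
    integral_congr_ae <| (ae_sphereUniform_mem_sphere d).mono fun θ hθ => by
      simp only [min_eq_left (hbound hθ)]
  rw [hint] at key
  simpa only [min_eq_left (hbound (hsphere _ _))] using key
end
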